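/- arXiv:2309.00097 — 2 statements merged into one kernel-verified Lean document; each statement's English description precedes it below -/
import Mathlib

section
/- Let α > 1 be a real number and let 𝓕 be a family of k-element subsets of [n] with |𝓕| > α^k. Then there exists a set X ⊆ [n] with |X| < k such that the family 𝓕(X) is α-spread. -/
open scoped Classical

/-- `𝓖(X) = {A \ X : A ∈ 𝓖, X ⊆ A}`. -/
def famRes {n : ℕ} (𝓖 : Finset (Finset (Fin n))) (X : Finset (Fin n)) :
    Finset (Finset (Fin n)) :=
  (𝓖.filter fun A => X ⊆ A).image fun A => A \ X

/-- A family `𝓖` is `α`-spread if `|𝓖(Y)| ≤ α^{-|Y|}·|𝓖|` for every set `Y`. -/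
def RSpread {n : ℕ} (α : ℝ) (𝓖 : Finset (Finset (Fin n))) : Prop :=
  ∀ Y : Finset (Fin n), ((famRes 𝓖 Y).card : ℝ) * α ^ Y.card ≤ (𝓖.card : ℝ)

/-- Removing a common subset is injective, so `𝓖(X)` counts the members of `𝓖` containing `X`. -/
theorem card_famRes {n : ℕ} (𝓖 : Finset (Finset (Fin n))) (X : Finset (Fin n)) :
    (famRes 𝓖 X).card = (𝓖.filter fun A => X ⊆ A).card := by
  refine Finset.card_image_of_injOn fun A hA B hB hAB => ?_
  rw [Finset.mem_coe, Finset.mem_filter] at hA hB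
  rw [← Finset.sdiff_union_of_subset hA.2, ← Finset.sdiff_union_of_subset hB.2]
  exact congrArg (· ∪ X) hAB

theorem famRes_famRes_of_disjoint {n : ℕ} (𝓖 : Finset (Finset (Fin n)))
    {X Y : Finset (Fin n)} (h : Disjoint X Y) :
    famRes (famRes 𝓖 X) Y = famRes 𝓖 (X ∪ Y) := by
  ext B
  simp only [famRes, Finset.mem_image, Finset.mem_filter]
  constructor
  · rintro ⟨_, ⟨⟨A, ⟨hA, hX⟩, rfl⟩, hY⟩, rfl⟩
    exact ⟨A, ⟨hA, Finset.union_subset hX (hY.trans Finset.sdiff_subset)⟩,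
      sdiff_sdiff_left.symm⟩
  · rintro ⟨A, ⟨hA, hXY⟩, rfl⟩
    obtain ⟨hX, hY⟩ := Finset.union_subset_iff.mp hXY
    exact ⟨A \ X, ⟨⟨A, ⟨hA, hX⟩, rfl⟩, Finset.subset_sdiff.mpr ⟨hY, h.symm⟩⟩, sdiff_sdiff_left⟩

theorem famRes_famRes_of_not_disjoint {n : ℕ} (𝓖 : Finset (Finset (Fin n)))
    {X Y : Finset (Fin n)} (h : ¬Disjoint X Y) : famRes (famRes 𝓖 X) Y = ∅ := by
  rw [famRes, Finset.image_eq_empty, Finset.filter_eq_empty_iff]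
  intro B hB hY
  obtain ⟨A, -, rfl⟩ := Finset.mem_image.mp hB
  exact h (Finset.subset_sdiff.mp hY).2.symm

/-- A set `X` maximizing `|𝓖(X)| * α ^ |X|` has a spread restriction. -/
theorem RSpread.famRes_of_maximal {n : ℕ} {α : ℝ} (hα : 0 < α) (𝓖 : Finset (Finset (Fin n)))
    {X : Finset (Fin n)}
    (hX : ∀ Z : Finset (Fin n),
      ((famRes 𝓖 Z).card : ℝ) * α ^ Z.card ≤ ((famRes 𝓖 X).card : ℝ) * α ^ X.card) :
    RSpread α (famRes 𝓖 X) := by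
  intro Y
  by_cases h : Disjoint X Y
  · have hXY := hX (X ∪ Y)
    rw [Finset.card_union_of_disjoint h, pow_add, mul_left_comm, mul_comm (α ^ X.card)] at hXY
    rw [famRes_famRes_of_disjoint 𝓖 h]
    refine le_of_mul_le_mul_right ?_ (pow_pos hα X.card)
    linarith
  · simp [famRes_famRes_of_not_disjoint 𝓖 h]

/-- In a `k`-uniform family, a set of size at least `k` has weight at most `α ^ k`. -/
theorem card_famRes_mul_pow_le {n k : ℕ} {α : ℝ} (hα : 0 < α) {𝓕 : Finset (Finset (Fin n))}
    (h𝓕 : ∀ A ∈ 𝓕, A.card = k) {X : Finset (Fin n)} (hX : k ≤ X.card) :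
    ((famRes 𝓕 X).card : ℝ) * α ^ X.card ≤ α ^ k := by
  have hsub : (𝓕.filter fun A => X ⊆ A) ⊆ {X} := by
    intro A hA
    rw [Finset.mem_filter] at hA
    rw [Finset.mem_singleton]
    exact (Finset.eq_of_subset_of_card_le hA.2 ((h𝓕 A hA.1).trans_le hX)).symm
  rw [card_famRes]
  rcases Finset.subset_singleton_iff.mp hsub with h | h
  · simp only [h, Finset.card_empty, Nat.cast_zero, zero_mul]
    positivity
  · have hmem : X ∈ 𝓕 := (Finset.mem_filter.mp (h ▸ Finset.mem_singleton_self X)).1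
    simp [h, h𝓕 X hmem]

theorem stmt8 (n k : ℕ) (α : ℝ) (hα : 1 < α)
    (𝓕 : Finset (Finset (Fin n))) (h𝓕 : ∀ A ∈ 𝓕, A.card = k)
    (hcard : α ^ k < (𝓕.card : ℝ)) :
    ∃ X : Finset (Fin n), X.card < k ∧ RSpread α (famRes 𝓕 X) := by
  obtain ⟨X, -, hX⟩ := Finset.exists_max_image (Finset.univ : Finset (Finset (Fin n)))
    (fun X => ((famRes 𝓕 X).card : ℝ) * α ^ X.card) Finset.univ_nonempty
  have hα0 : 0 < α := zero_lt_one.trans hα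
  refine ⟨X, ?_, RSpread.famRes_of_maximal hα0 𝓕 fun Z => hX Z (Finset.mem_univ Z)⟩
  by_contra! hk
  have hle := (hX ∅ (Finset.mem_univ _)).trans (card_famRes_mul_pow_le hα0 h𝓕 hk)
  rw [card_famRes] at hle
  simp only [Finset.empty_subset, Finset.filter_true, Finset.card_empty, pow_zero, mul_one] at hle
  exact hle.not_gt hcard
end

section
/- Let s ≥ 2 be an integer and let B̃_s denote the number of partitions of [s] all of whose parts have size at least 2. Then B̃_s ≥ (1/2)·∏_{i=2}^{s−1} (1 − 2·log(i+1)/(i+1))·(1 − (2i+2)/3^i) · B_s, where log denotes the natural logarithm and the empty product (for s = 2) equals 1. -/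
open scoped Classical

/-- A partition of `[s]` (modeled as `Fin s`): a set of pairwise disjoint nonempty
subsets whose union is everything. -/
def IsPartition {n : ℕ} (P : Finset (Finset (Fin n))) : Prop :=
  ∅ ∉ P ∧ (∀ p ∈ P, ∀ q ∈ P, p ≠ q → Disjoint p q) ∧ ∀ x : Fin n, ∃ p ∈ P, x ∈ p

/-- The `s`-th Bell number: the number of partitions of `[s]`. -/
noncomputable def bell (s : ℕ) : ℕ :=
  (Finset.univ.filter fun P : Finset (Finset (Fin s)) => IsPartition P).card

/-- `B̃_s`: the number of partitions of `[s]` all of whose parts have size at least `2`. -/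
noncomputable def bellTilde (s : ℕ) : ℕ :=
  (Finset.univ.filter fun P : Finset (Finset (Fin s)) =>
    IsPartition P ∧ ∀ p ∈ P, 2 ≤ p.card).card

theorem isPartition_eq_of_mem {n : ℕ} {P : Finset (Finset (Fin n))} (h : IsPartition P)
    {p q : Finset (Fin n)} (hp : p ∈ P) (hq : q ∈ P) {x : Fin n} (hxp : x ∈ p) (hxq : x ∈ q) :
    p = q := by
  by_contra hne
  exact Finset.disjoint_left.mp (h.2.1 p hp q hq hne) hxp hxq

theorem two_le_card_of_mem {n : ℕ} {P : Finset (Finset (Fin n))} (h : IsPartition P)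
    {p : Finset (Fin n)} (hp : p ∈ P) (h1 : p.card ≠ 1) : 2 ≤ p.card := by
  have h0 : p.card ≠ 0 := by
    rw [Finset.card_ne_zero, Finset.nonempty_iff_ne_empty]
    rintro rfl
    exact h.1 hp
  omega

/-- Break the part containing `x` into singletons. -/
noncomputable def explodePart {n : ℕ} (Q : Finset (Finset (Fin n))) (x : Fin n) :
    Finset (Finset (Fin n)) :=
  Q.filter (x ∉ ·) ∪ (Q.filter (x ∈ ·)).biUnion fun b => b.image fun y => {y}

/-- Remove `x` from its part and make it a singleton. -/
noncomputable def isolatePoint {n : ℕ} (Q : Finset (Finset (Fin n))) (x : Fin n) :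
    Finset (Finset (Fin n)) :=
  insert {x} (Q.image fun b => b.erase x)

theorem exists_explodePart {n : ℕ} {P : Finset (Finset (Fin n))} (h : IsPartition P)
    {x y : Fin n} (hxy : x ≠ y) (hx : {x} ∈ P) (hy : {y} ∈ P) :
    ∃ Q, (IsPartition Q ∧ ∀ p ∈ Q, 2 ≤ p.card) ∧ explodePart Q x = P := by
  set S : Finset (Fin n) := Finset.univ.filter fun z => {z} ∈ P with hS
  have memS : ∀ z, z ∈ S ↔ {z} ∈ P := by simp [hS]
  have hdisj : ∀ p ∈ P, p.card ≠ 1 → Disjoint S p := by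
    intro p hp h1
    rw [Finset.disjoint_left]
    intro z hz hzp
    have := isPartition_eq_of_mem h ((memS z).1 hz) hp (Finset.mem_singleton_self z) hzp
    subst this
    simp at h1
  have hxS : x ∈ S := (memS x).2 hx
  have hS2 : 2 ≤ S.card := Finset.one_lt_card.2 ⟨x, hxS, y, (memS y).2 hy, hxy⟩
  refine ⟨insert S (P.filter fun p => p.card ≠ 1), ⟨⟨?_, ?_, ?_⟩, ?_⟩, ?_⟩
  · intro h0
    rw [Finset.mem_insert, Finset.mem_filter] at h0
    rcases h0 with h0 | h0
    · rw [← h0] at hxS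
      simp at hxS
    · exact h.1 h0.1
  · intro p hp q hq hpq
    rw [Finset.mem_insert, Finset.mem_filter] at hp hq
    rcases hp with rfl | hp <;> rcases hq with rfl | hq
    · exact absurd rfl hpq
    · exact hdisj q hq.1 hq.2
    · exact (hdisj p hp.1 hp.2).symm
    · exact h.2.1 p hp.1 q hq.1 hpq
  · intro z
    obtain ⟨p, hp, hz⟩ := h.2.2 z
    by_cases h1 : p.card = 1
    · obtain ⟨w, rfl⟩ := Finset.card_eq_one.1 h1
      rw [Finset.mem_singleton] at hz
      subst hz
      exact ⟨S, Finset.mem_insert_self _ _, (memS z).2 hp⟩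
    · exact ⟨p, by simp [hp, h1], hz⟩
  · intro p hp
    rw [Finset.mem_insert, Finset.mem_filter] at hp
    rcases hp with rfl | hp
    · exact hS2
    · exact two_le_card_of_mem h hp.1 hp.2
  · ext p
    simp only [explodePart, Finset.mem_union, Finset.mem_filter, Finset.mem_insert,
      Finset.mem_biUnion, Finset.mem_image]
    constructor
    · rintro (⟨rfl | hp, hxp⟩ | ⟨b, ⟨rfl | hb, hxb⟩, z, hz, rfl⟩)
      · exact absurd hxS hxp
      · exact hp.1
      · exact (memS z).1 hz
      · exact absurd hxb (Finset.disjoint_left.1 (hdisj b hb.1 hb.2) hxS)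
    · intro hp
      by_cases h1 : p.card = 1
      · obtain ⟨w, rfl⟩ := Finset.card_eq_one.1 h1
        exact Or.inr ⟨S, ⟨Or.inl rfl, hxS⟩, w, (memS w).2 hp, rfl⟩
      · exact Or.inl ⟨Or.inr ⟨hp, h1⟩, Finset.disjoint_left.1 (hdisj p hp h1) hxS⟩

theorem exists_isolatePoint {n : ℕ} (hn : 2 ≤ n) {P : Finset (Finset (Fin n))}
    (h : IsPartition P) {x : Fin n} (hx : {x} ∈ P) (huniq : ∀ y, {y} ∈ P → y = x) :
    ∃ Q, (IsPartition Q ∧ ∀ p ∈ Q, 2 ≤ p.card) ∧ isolatePoint Q x = P := by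
  have card_two : ∀ p ∈ P, p ≠ {x} → 2 ≤ p.card := by
    intro p hp hpx
    refine two_le_card_of_mem h hp fun h1 => ?_
    obtain ⟨w, rfl⟩ := Finset.card_eq_one.1 h1
    exact hpx (by rw [huniq w hp])
  have notMem : ∀ p ∈ P, p ≠ {x} → x ∉ p := fun p hp hpx hxp =>
    hpx (isPartition_eq_of_mem h hp hx hxp (Finset.mem_singleton_self x))
  have : Nontrivial (Fin n) := Fin.nontrivial_iff_two_le.2 hn
  obtain ⟨y, hyx⟩ := exists_ne x
  obtain ⟨p, hp, hyp⟩ := h.2.2 y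
  have hpx : p ≠ {x} := by
    rintro rfl
    exact hyx (Finset.mem_singleton.1 hyp)
  have hxp := notMem p hp hpx
  refine ⟨insert (insert x p) (P.filter fun q => q ≠ {x} ∧ q ≠ p), ⟨⟨?_, ?_, ?_⟩, ?_⟩, ?_⟩
  · intro h0
    rw [Finset.mem_insert, Finset.mem_filter] at h0
    rcases h0 with h0 | h0
    · exact Finset.insert_ne_empty x p h0.symm
    · exact h.1 h0.1
  · have key : ∀ q ∈ P, q ≠ {x} → q ≠ p → Disjoint (insert x p) q := by
      intro q hq hqx hqp
      rw [Finset.disjoint_insert_left]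
      exact ⟨notMem q hq hqx, h.2.1 p hp q hq hqp.symm⟩
    intro q hq r hr hqr
    rw [Finset.mem_insert, Finset.mem_filter] at hq hr
    rcases hq with rfl | hq <;> rcases hr with rfl | hr
    · exact absurd rfl hqr
    · exact key r hr.1 hr.2.1 hr.2.2
    · exact (key q hq.1 hq.2.1 hq.2.2).symm
    · exact h.2.1 q hq.1 r hr.1 hqr
  · intro z
    obtain ⟨q, hq, hz⟩ := h.2.2 z
    by_cases hq' : q ≠ {x} ∧ q ≠ p
    · exact ⟨q, by simp [hq, hq'], hz⟩
    · refine ⟨insert x p, Finset.mem_insert_self _ _, ?_⟩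
      grind
  · intro q hq
    rw [Finset.mem_insert, Finset.mem_filter] at hq
    rcases hq with rfl | hq
    · exact (card_two p hp hpx).trans (Finset.card_le_card (Finset.subset_insert x p))
    · exact card_two q hq.1 hq.2.1
  · ext q
    simp only [isolatePoint, Finset.mem_filter, Finset.mem_insert, Finset.mem_image]
    constructor
    · rintro (rfl | ⟨b, rfl | hb, rfl⟩)
      · exact hx
      · rwa [Finset.erase_insert hxp]
      · rw [Finset.erase_eq_of_notMem (notMem b hb.1 hb.2.1)]
        exact hb.1
    · intro hq
      by_cases hqx : q = {x}
      · exact Or.inl hqx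
      by_cases hqp : q = p
      · exact Or.inr ⟨insert x p, Or.inl rfl, by rw [Finset.erase_insert hxp, hqp]⟩
      · exact Or.inr ⟨q, Or.inr ⟨hq, hqx, hqp⟩, Finset.erase_eq_of_notMem (notMem q hq hqx)⟩

theorem bell_le_mul_bellTilde {s : ℕ} (hs : 2 ≤ s) : bell s ≤ (2 * s + 1) * bellTilde s := by
  set T := Finset.univ.filter fun P : Finset (Finset (Fin s)) =>
    IsPartition P ∧ ∀ p ∈ P, 2 ≤ p.card with hT
  have hsub : (Finset.univ.filter fun P : Finset (Finset (Fin s)) => IsPartition P) ⊆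
      (T ×ˢ Finset.univ).image (fun a : _ × Fin s => explodePart a.1 a.2) ∪
        (T ×ˢ Finset.univ).image (fun a : _ × Fin s => isolatePoint a.1 a.2) ∪ T := by
    intro P hP
    have h : IsPartition P := (Finset.mem_filter.1 hP).2
    rw [Finset.mem_union, Finset.mem_union]
    by_cases hx : ∃ x, {x} ∈ P
    · obtain ⟨x, hx⟩ := hx
      left
      by_cases hy : ∃ y, {y} ∈ P ∧ y ≠ x
      · obtain ⟨y, hy, hyx⟩ := hy
        obtain ⟨Q, hQ, rfl⟩ := exists_explodePart h hyx.symm hx hy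
        exact Or.inl (Finset.mem_image.2 ⟨(Q, x), by simpa [hT] using hQ, rfl⟩)
      · push Not at hy
        obtain ⟨Q, hQ, rfl⟩ := exists_isolatePoint hs h hx hy
        exact Or.inr (Finset.mem_image.2 ⟨(Q, x), by simpa [hT] using hQ, rfl⟩)
    · right
      refine Finset.mem_filter.2 ⟨Finset.mem_univ _, h, fun p hp => ?_⟩
      refine two_le_card_of_mem h hp fun h1 => ?_
      obtain ⟨w, rfl⟩ := Finset.card_eq_one.1 h1
      exact hx ⟨w, hp⟩
  have hcard : ∀ f : Finset (Finset (Fin s)) × Fin s → Finset (Finset (Fin s)),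
      ((T ×ˢ Finset.univ).image f).card ≤ T.card * s := fun f =>
    Finset.card_image_le.trans (by simp)
  calc bell s ≤ _ := Finset.card_le_card hsub
    _ ≤ T.card * s + T.card * s + T.card :=
      (Finset.card_union_le _ _).trans (Nat.add_le_add_right
        ((Finset.card_union_le _ _).trans (Nat.add_le_add (hcard _) (hcard _))) _)
    _ = (2 * s + 1) * bellTilde s := by
      rw [show bellTilde s = T.card from rfl]
      ring

theorem bell_two_le : bell 2 ≤ 2 := by
  have hsub : (Finset.univ.filter fun P : Finset (Finset (Fin 2)) => IsPartition P) ⊆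
      {{{0}, {1}}, {{0, 1}}} := by
    have key : ∀ P : Finset (Finset (Fin 2)),
        (∅ ∉ P ∧ (∀ p ∈ P, ∀ q ∈ P, p ≠ q → Disjoint p q) ∧ ∀ x : Fin 2, ∃ p ∈ P, x ∈ p) →
          P ∈ ({{{0}, {1}}, {{0, 1}}} : Finset _) := by
      decide
    exact fun P hP => key P (Finset.mem_filter.1 hP).2
  exact (Finset.card_le_card hsub).trans Finset.card_le_two

theorem one_le_bellTilde_two : 1 ≤ bellTilde 2 := by
  refine Finset.card_pos.2 ⟨{{0, 1}}, Finset.mem_filter.2 ⟨Finset.mem_univ _, ?_⟩⟩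
  unfold IsPartition
  decide

theorem log_factor_bounds {i : ℕ} (hi : 2 ≤ i) :
    0 ≤ 1 - 2 * Real.log (i + 1) / ((i : ℝ) + 1) ∧
      1 - 2 * Real.log (i + 1) / ((i : ℝ) + 1) ≤ ((i : ℝ) - 1) / (i + 1) := by
  have hi' : (2 : ℝ) ≤ i := by exact_mod_cast hi
  have hpos : (0 : ℝ) < (i : ℝ) + 1 := by linarith
  have h1 : 1 ≤ Real.log ((i : ℝ) + 1) := by
    rw [Real.le_log_iff_exp_le hpos]
    linarith [Real.exp_one_lt_d9]
  have h2 : Real.log ((i : ℝ) + 1) ≤ ((i : ℝ) + 1) / 2 := by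
    have := Real.log_le_sub_one_of_pos (half_pos hpos)
    rw [Real.log_div hpos.ne' two_ne_zero] at this
    linarith [Real.log_two_lt_d9]
  constructor
  · rw [sub_nonneg, div_le_one hpos]
    linarith
  · rw [one_sub_div hpos.ne']
    exact div_le_div_of_nonneg_right (by linarith) hpos.le

theorem geometric_factor_bounds {i : ℕ} (hi : 2 ≤ i) :
    0 ≤ 1 - (2 * (i : ℝ) + 2) / 3 ^ i ∧ 1 - (2 * (i : ℝ) + 2) / 3 ^ i ≤ 1 := by
  have h : 2 * i + 2 ≤ 3 ^ i := by
    induction i, hi using Nat.le_induction with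
    | base => norm_num
    | succ k hk ih =>
      rw [pow_succ]
      omega
  constructor
  · rw [sub_nonneg, div_le_one (by positivity)]
    exact_mod_cast h
  · rw [sub_le_self_iff]
    positivity

theorem prod_factor_bounds {s : ℕ} (hs : 2 ≤ s) :
    0 ≤ ∏ i ∈ Finset.Icc 2 s,
        (1 - 2 * Real.log (i + 1) / ((i : ℝ) + 1)) * (1 - (2 * (i : ℝ) + 2) / 3 ^ i) ∧
      ∏ i ∈ Finset.Icc 2 s,
        (1 - 2 * Real.log (i + 1) / ((i : ℝ) + 1)) * (1 - (2 * (i : ℝ) + 2) / 3 ^ i) ≤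
          2 / (3 * ((s : ℝ) * (s + 1))) := by
  induction s, hs using Nat.le_induction with
  | base =>
    have h := log_factor_bounds le_rfl
    rw [Finset.Icc_self, Finset.prod_singleton]
    norm_num at h ⊢
    constructor <;> linarith
  | succ k hk ih =>
    have hk' : (2 : ℝ) ≤ k := by exact_mod_cast hk
    have hl := log_factor_bounds (hk.trans k.le_succ)
    have hg := geometric_factor_bounds (hk.trans k.le_succ)
    rw [Finset.prod_Icc_succ_top (by omega)]
    refine ⟨mul_nonneg ih.1 (mul_nonneg hl.1 hg.1), ?_⟩
    refine (mul_le_mul ih.2 (mul_le_of_le_one_right hl.1 hg.2 |>.trans hl.2)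
      (mul_nonneg hl.1 hg.1) (by positivity)).trans (le_of_eq ?_)
    push_cast
    field_simp
    ring

theorem stmt12 (s : ℕ) (hs : 2 ≤ s) :
    (1 / 2 : ℝ) *
        (∏ i ∈ Finset.Icc 2 (s - 1),
          (1 - 2 * Real.log (i + 1) / ((i : ℝ) + 1)) * (1 - (2 * (i : ℝ) + 2) / 3 ^ i)) *
        (bell s : ℝ) ≤ (bellTilde s : ℝ) := by
  obtain rfl | hs3 := hs.eq_or_lt
  · have h1 : (bell 2 : ℝ) ≤ 2 := by exact_mod_cast bell_two_le
    have h2 : (1 : ℝ) ≤ bellTilde 2 := by exact_mod_cast one_le_bellTilde_two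
    norm_num
    linarith
  · obtain ⟨t, rfl⟩ : ∃ t, s = t + 1 := ⟨s - 1, by omega⟩
    have ht : 2 ≤ t := by omega
    have ht' : (2 : ℝ) ≤ t := by exact_mod_cast ht
    have hB : (bell (t + 1) : ℝ) ≤ (2 * (t + 1) + 1) * bellTilde (t + 1) := by
      exact_mod_cast bell_le_mul_bellTilde hs
    rw [Nat.add_sub_cancel]
    obtain ⟨hP0, hP⟩ := prod_factor_bounds ht
    set p := ∏ i ∈ Finset.Icc 2 t,
      (1 - 2 * Real.log (i + 1) / ((i : ℝ) + 1)) * (1 - (2 * (i : ℝ) + 2) / 3 ^ i)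
    have hle : 1 / 2 * p * (2 * (t + 1) + 1) ≤ 1 := by
      calc 1 / 2 * p * (2 * (t + 1) + 1)
          ≤ 1 / 2 * (2 / (3 * ((t : ℝ) * (t + 1)))) * (2 * (t + 1) + 1) := by gcongr
        _ = (2 * t + 3) / (3 * ((t : ℝ) * (t + 1))) := by
          field_simp
          ring
        _ ≤ 1 := by
          rw [div_le_one (by positivity)]
          nlinarith
    calc 1 / 2 * p * bell (t + 1)
        ≤ 1 / 2 * p * ((2 * (t + 1) + 1) * bellTilde (t + 1)) := by gcongr
      _ = 1 / 2 * p * (2 * (t + 1) + 1) * bellTilde (t + 1) := by ring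
      _ ≤ bellTilde (t + 1) := mul_le_of_le_one_left (Nat.cast_nonneg _) hle
end
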